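/- arXiv:2209.00957 — 3 statements merged into one kernel-verified Lean document; each statement's English description precedes it below -/
import Mathlib

section
/- Let 𝕜 be a field, and let X^i, X̃^i (i ∈ ℤ) be 𝕜-vector spaces with linear maps d^i : X^i → X^{i+1}, d̃^i : X̃^i → X̃^{i+1}, reductions R^i : X^i → X̃^i and extensions E^i : X̃^i → X^i. Assume (Cpx): d^{i+1} ∘ d^i = 0 for all i; (C1): R^i ∘ E^i = id on X̃^i for all i; (C2): (E^{i+1} ∘ R^{i+1} − id)(ker d^{i+1}) ⊆ range d^i for all i; and (C3): d̃^i ∘ R^i = R^{i+1} ∘ d^i and d^i ∘ E^i = E^{i+1} ∘ d̃^i for all i. Then for each i the reduction R^i induces a linear isomorphism from H^i = ker d^i / range d^{i-1} onto H̃^i = ker d̃^i / range d̃^{i-1}. -/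
/-- Under (Cpx), (C1), (C2) and (C3), in each degree (written `i + 1` with `i`
ranging over all of `ℤ`) the reduction `R^{i+1}` induces a linear isomorphism from the
cohomology space `H^{i+1} = ker d^{i+1} / range d^i` onto
`H̃^{i+1} = ker d̃^{i+1} / range d̃^i`. -/
theorem stmt_5 (𝕜 : Type*) [Field 𝕜]
    (X X' : ℤ → Type*) [∀ i, AddCommGroup (X i)] [∀ i, Module 𝕜 (X i)]
    [∀ i, AddCommGroup (X' i)] [∀ i, Module 𝕜 (X' i)]
    (d : ∀ i, X i →ₗ[𝕜] X (i + 1)) (d' : ∀ i, X' i →ₗ[𝕜] X' (i + 1))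
    (R : ∀ i, X i →ₗ[𝕜] X' i) (E : ∀ i, X' i →ₗ[𝕜] X i)
    (hCpx : ∀ i (x : X i), d (i + 1) (d i x) = 0)
    (hC1 : ∀ i (y : X' i), R i (E i y) = y)
    (hC2 : ∀ i (x : X (i + 1)), x ∈ LinearMap.ker (d (i + 1)) →
      E (i + 1) (R (i + 1) x) - x ∈ LinearMap.range (d i))
    (hC3R : ∀ i (x : X i), d' i (R i x) = R (i + 1) (d i x))
    (hC3E : ∀ i (y : X' i), d i (E i y) = E (i + 1) (d' i y)) :
    ∀ i, ∃ e :
      (LinearMap.ker (d (i + 1)) ⧸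
        Submodule.comap (LinearMap.ker (d (i + 1))).subtype (LinearMap.range (d i)))
      ≃ₗ[𝕜]
      (LinearMap.ker (d' (i + 1)) ⧸
        Submodule.comap (LinearMap.ker (d' (i + 1))).subtype (LinearMap.range (d' i))),
      ∀ (y : X (i + 1)) (hy : y ∈ LinearMap.ker (d (i + 1)))
          (hy' : R (i + 1) y ∈ LinearMap.ker (d' (i + 1))),
        e (Submodule.Quotient.mk ⟨y, hy⟩) = Submodule.Quotient.mk ⟨R (i + 1) y, hy'⟩ := by
  intro i
  have hR : ∀ x ∈ LinearMap.ker (d (i + 1)), R (i + 1) x ∈ LinearMap.ker (d' (i + 1)) := by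
    intro x hx
    rw [LinearMap.mem_ker] at hx ⊢
    rw [hC3R, hx, map_zero]
  have hE : ∀ y ∈ LinearMap.ker (d' (i + 1)), E (i + 1) y ∈ LinearMap.ker (d (i + 1)) := by
    intro y hy
    rw [LinearMap.mem_ker] at hy ⊢
    rw [hC3E, hy, map_zero]
  let f := Submodule.mapQ
    (Submodule.comap (LinearMap.ker (d (i + 1))).subtype (LinearMap.range (d i)))
    (Submodule.comap (LinearMap.ker (d' (i + 1))).subtype (LinearMap.range (d' i)))
    ((R (i + 1)).restrict hR) (by
      rintro ⟨_, hx⟩ ⟨w, rfl⟩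
      exact ⟨R i w, hC3R i w⟩)
  let g := Submodule.mapQ
    (Submodule.comap (LinearMap.ker (d' (i + 1))).subtype (LinearMap.range (d' i)))
    (Submodule.comap (LinearMap.ker (d (i + 1))).subtype (LinearMap.range (d i)))
    ((E (i + 1)).restrict hE) (by
      rintro ⟨_, hy⟩ ⟨w, rfl⟩
      exact ⟨E i w, hC3E i w⟩)
  refine ⟨LinearEquiv.ofLinearMap f g ?_ ?_, fun y hy hy' => rfl⟩
  · refine Submodule.linearMap_qext _ (LinearMap.ext fun y => ?_)
    exact congrArg Submodule.Quotient.mk (Subtype.ext (hC1 (i + 1) y))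
  · refine Submodule.linearMap_qext _ (LinearMap.ext fun x => ?_)
    exact (Submodule.Quotient.eq _).2 (hC2 i x x.2)
end

section
/- Let 𝕜 be a field, and let X^i, X̃^i (i ∈ ℤ) be 𝕜-vector spaces with linear maps d^i : X^i → X^{i+1}, d̃^i : X̃^i → X̃^{i+1}, reductions R^i : X^i → X̃^i and extensions E^i : X̃^i → X^i. Assume (Cpx): d^{i+1} ∘ d^i = 0 for all i; (C1): R^i ∘ E^i = id on X̃^i for all i; and (C3): d̃^i ∘ R^i = R^{i+1} ∘ d^i and d^i ∘ E^i = E^{i+1} ∘ d̃^i for all i. Then for each i the following are equivalent: (a) (E^{i+1} ∘ R^{i+1} − id)(ker d^{i+1}) ⊆ range d^i; (b) the zero-reduction subcomplex is exact at degree i+1, i.e. ker d^{i+1} ∩ ker R^{i+1} ⊆ d^i(ker R^i). -/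
/-- Under (Cpx), (C1) and (C3), for each `i` property (C2) at degree `i + 1`
is equivalent to exactness of the zero-reduction subcomplex at degree `i + 1`, i.e.
`ker d^{i+1} ∩ ker R^{i+1} ⊆ d^i (ker R^i)`. -/
theorem stmt_8 (𝕜 : Type*) [Field 𝕜]
    (X X' : ℤ → Type*) [∀ i, AddCommGroup (X i)] [∀ i, Module 𝕜 (X i)]
    [∀ i, AddCommGroup (X' i)] [∀ i, Module 𝕜 (X' i)]
    (d : ∀ i, X i →ₗ[𝕜] X (i + 1)) (d' : ∀ i, X' i →ₗ[𝕜] X' (i + 1))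
    (R : ∀ i, X i →ₗ[𝕜] X' i) (E : ∀ i, X' i →ₗ[𝕜] X i)
    (hCpx : ∀ i (x : X i), d (i + 1) (d i x) = 0)
    (hC1 : ∀ i (y : X' i), R i (E i y) = y)
    (hC3R : ∀ i (x : X i), d' i (R i x) = R (i + 1) (d i x))
    (hC3E : ∀ i (y : X' i), d i (E i y) = E (i + 1) (d' i y)) :
    ∀ i,
      (∀ x : X (i + 1), x ∈ LinearMap.ker (d (i + 1)) →
        E (i + 1) (R (i + 1) x) - x ∈ LinearMap.range (d i)) ↔
      (∀ x : X (i + 1), x ∈ LinearMap.ker (d (i + 1)) → x ∈ LinearMap.ker (R (i + 1)) →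
        ∃ y ∈ LinearMap.ker (R i), d i y = x) := by
  intro i
  simp only [LinearMap.mem_ker, LinearMap.mem_range]
  constructor
  · intro h x hx hRx
    obtain ⟨z, hz⟩ := h x hx
    rw [hRx, map_zero, zero_sub] at hz
    refine ⟨E i (R i z) - z, ?_, ?_⟩
    · rw [map_sub, hC1, sub_self]
    · rw [map_sub, hC3E, hC3R, hz, map_neg, hRx, neg_zero, map_zero, zero_sub, neg_neg]
  · intro h x hx
    obtain ⟨y, -, hy⟩ := h (E (i + 1) (R (i + 1) x) - x)
      (by rw [map_sub, hC3E, hC3R, hx, map_zero, map_zero, sub_zero])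
      (by rw [map_sub, hC1, sub_self])
    exact ⟨y, hy⟩
end

section
/- Let 𝕜 be a field, and let X^i, X̃^i (i ∈ ℤ) be 𝕜-vector spaces with linear maps d^i : X^i → X^{i+1}, d̃^i : X̃^i → X̃^{i+1}, reductions R^i : X^i → X̃^i and extensions E^i : X̃^i → X^i. Assume (Cpx): d^{i+1} ∘ d^i = 0 for all i; (C1): R^i ∘ E^i = id on X̃^i for all i; (C2): (E^{i+1} ∘ R^{i+1} − id)(ker d^{i+1}) ⊆ range d^i for all i; and (C3): d̃^i ∘ R^i = R^{i+1} ∘ d^i and d^i ∘ E^i = E^{i+1} ∘ d̃^i for all i. Then for each i, the complex (X, d) is exact at degree i (i.e. ker d^i ⊆ range d^{i-1}) if and only if the complex (X̃, d̃) is exact at degree i (i.e. ker d̃^i ⊆ range d̃^{i-1}). -/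
/-- Under (Cpx), (C1), (C2) and (C3), for each degree the complex `(X, d)` is
exact if and only if the complex `(X̃, d̃)` is exact (degrees shifted by one, `i` over all `ℤ`):
`ker d^{i+1} ⊆ range d^i` iff `ker d̃^{i+1} ⊆ range d̃^i`. -/
theorem stmt_11 (𝕜 : Type*) [Field 𝕜]
    (X X' : ℤ → Type*) [∀ i, AddCommGroup (X i)] [∀ i, Module 𝕜 (X i)]
    [∀ i, AddCommGroup (X' i)] [∀ i, Module 𝕜 (X' i)]
    (d : ∀ i, X i →ₗ[𝕜] X (i + 1)) (d' : ∀ i, X' i →ₗ[𝕜] X' (i + 1))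
    (R : ∀ i, X i →ₗ[𝕜] X' i) (E : ∀ i, X' i →ₗ[𝕜] X i)
    (hCpx : ∀ i (x : X i), d (i + 1) (d i x) = 0)
    (hC1 : ∀ i (y : X' i), R i (E i y) = y)
    (hC2 : ∀ i (x : X (i + 1)), x ∈ LinearMap.ker (d (i + 1)) →
      E (i + 1) (R (i + 1) x) - x ∈ LinearMap.range (d i))
    (hC3R : ∀ i (x : X i), d' i (R i x) = R (i + 1) (d i x))
    (hC3E : ∀ i (y : X' i), d i (E i y) = E (i + 1) (d' i y)) :
    ∀ i,
      (∀ x : X (i + 1), x ∈ LinearMap.ker (d (i + 1)) → x ∈ LinearMap.range (d i)) ↔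
      (∀ y : X' (i + 1), y ∈ LinearMap.ker (d' (i + 1)) → y ∈ LinearMap.range (d' i)) := by
  intro i
  constructor
  · intro h y hy
    rw [LinearMap.mem_ker] at hy
    obtain ⟨x, hx⟩ := h (E (i + 1) y) (by rw [LinearMap.mem_ker, hC3E, hy, map_zero])
    exact ⟨R i x, by rw [hC3R, hx, hC1]⟩
  · intro h x hx
    obtain ⟨y, hy⟩ := h (R (i + 1) x) (by
      rw [LinearMap.mem_ker, hC3R, LinearMap.mem_ker.mp hx, map_zero])
    obtain ⟨z, hz⟩ := hC2 i x hx
    exact ⟨E i y - z, by rw [map_sub, hC3E, hy, hz, sub_sub_cancel]⟩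
end
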